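/- arXiv:1511.00065 — 3 statements merged into one kernel-verified Lean document; each statement's English description precedes it below -/
import Mathlib

section
/- (Necessity: the integral equation for equilibrium strategies) Let σ be an equilibrium strategy converging to k∞ on the neighborhood N, and suppose the value function V(k₀) = ∫₀^∞ h(t)·u(σ(K(t;k₀,σ)),K(t;k₀,σ)) dt + ∫₀^∞ H(t)·U(σ(K(t;k₀,σ)),K(t;k₀,σ)) dt is well defined and differentiable on N. Then for every k₀ ∈ N: (i) u₁′(σ(k₀),k₀) + U₁′(σ(k₀),k₀) = V′(k₀), equivalently σ(k₀) = φ(V′(k₀),k₀); and consequently (ii) V satisfies the integral equation (IE): V(k₀) = ∫₀^∞ h(t)·u(φ(V′(K_t),K_t),K_t) dt + ∫₀^∞ H(t)·U(φ(V′(K_t),K_t),K_t) dt, where K_t = K(t;k₀,σ) and σ = φ(V′(·),·). -/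
open MeasureTheory Filter Set

noncomputable def pd1 (u : ℝ → ℝ → ℝ) (c k : ℝ) : ℝ := deriv (fun x => u x k) c
noncomputable def pd2 (u : ℝ → ℝ → ℝ) (c k : ℝ) : ℝ := deriv (fun y => u c y) k
noncomputable def pd11 (u : ℝ → ℝ → ℝ) (c k : ℝ) : ℝ := deriv (fun x => pd1 u x k) c

/-- The quantity `P(k₀,σ,c)`: the marginal gain from using the constant control `c` on a
vanishing commitment span, given the flow `K(t;k₀,σ)` and the linearized fundamental
solution `R(k₀;t)` of the strategy `σ`. -/
noncomputable def Pval (u U : ℝ → ℝ → ℝ) (h H : ℝ → ℝ) (σ : ℝ → ℝ)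
    (K R : ℝ → ℝ → ℝ) (k₀ c : ℝ) : ℝ :=
  u c k₀ - u (σ k₀) k₀ + (U c k₀ - U (σ k₀) k₀) +
  ∫ t in Set.Ioi (0:ℝ),
    (h t * (pd1 u (σ (K t k₀)) (K t k₀) * deriv σ (K t k₀) + pd2 u (σ (K t k₀)) (K t k₀)) +
     H t * (pd1 U (σ (K t k₀)) (K t k₀) * deriv σ (K t k₀) + pd2 U (σ (K t k₀)) (K t k₀)))
    * (R k₀ t * (σ k₀ - c))

theorem exists_abs_le_of_continuousOn_of_tendsto {g : ℝ → ℝ} {L : ℝ}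
    (hg : ContinuousOn g (Ici 0)) (hL : Tendsto g atTop (nhds L)) :
    ∃ C, ∀ t, 0 ≤ t → |g t| ≤ C := by
  obtain ⟨T, hT⟩ := eventually_atTop.1
    (hL.abs.eventually (eventually_le_nhds (lt_add_one |L|)))
  obtain ⟨C, hC⟩ := isCompact_Icc.exists_bound_of_continuousOn
    (hg.mono (Icc_subset_Ici_self : Icc 0 T ⊆ Ici 0))
  refine ⟨max C (|L| + 1), fun t ht => ?_⟩
  rcases le_total t T with h | h
  · exact (hC t ⟨ht, h⟩).trans (le_max_left _ _)
  · exact (hT t h).trans (le_max_right _ _)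

/-- A discount factor with exponential decay is integrable on the half line. -/
theorem integrableOn_of_antitoneOn_of_le_exp {h : ℝ → ℝ} {ρ T : ℝ}
    (hc : ContinuousOn h (Ici 0)) (ha : AntitoneOn h (Ici 0)) (hl : Tendsto h atTop (nhds 0))
    (hρ : 0 < ρ) (hT : ∀ t ≥ T, h t ≤ Real.exp (-ρ * t)) : IntegrableOn h (Ioi 0) := by
  have hnn : ∀ t, 0 ≤ t → 0 ≤ h t := fun t ht =>
    le_of_tendsto hl (eventually_atTop.2 ⟨t, fun s hs => ha ht (ht.trans hs) hs⟩)
  refine integrable_of_isBigO_exp_neg hρ hc (Asymptotics.IsBigO.of_bound 1 ?_)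
  filter_upwards [eventually_ge_atTop T, eventually_ge_atTop 0] with t h1 h2
  rw [Real.norm_eq_abs, abs_of_nonneg (hnn t h2), Real.norm_eq_abs, Real.abs_exp, one_mul]
  exact hT t h1

/-- Differentiation from the right, at the origin, of a discounted integral of shifts. -/
theorem hasDerivWithinAt_integral_mul_shift {h y y' : ℝ → ℝ} {C : ℝ}
    (hh : IntegrableOn h (Ioi 0)) (hy : ∀ t, 0 ≤ t → HasDerivAt y (y' t) t)
    (hC : ∀ t, 0 ≤ t → |y' t| ≤ C)
    (hint : ∀ s, 0 ≤ s → IntegrableOn (fun t => h t * y (t + s)) (Ioi 0)) :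
    HasDerivWithinAt (fun s => ∫ t in Ioi 0, h t * y (t + s)) (∫ t in Ioi 0, h t * y' t)
      (Ici 0) 0 := by
  rw [← hasDerivWithinAt_Ioi_iff_Ici, hasDerivWithinAt_iff_tendsto_slope' self_notMem_Ioi]
  have key : Tendsto (fun s => ∫ t in Ioi (0 : ℝ), s⁻¹ * (h t * y (t + s) - h t * y (t + 0)))
      (nhdsWithin 0 (Ioi 0)) (nhds (∫ t in Ioi 0, h t * y' t)) := by
    refine MeasureTheory.tendsto_integral_filter_of_dominated_convergence
      (fun t => ‖h t‖ * C) ?_ ?_ (hh.norm.mul_const C) ?_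
    · filter_upwards [self_mem_nhdsWithin] with s hs
      exact (((hint s (le_of_lt hs)).sub (hint 0 le_rfl)).const_mul _).aestronglyMeasurable
    · filter_upwards [self_mem_nhdsWithin] with s hs
      filter_upwards [ae_restrict_mem measurableSet_Ioi] with t ht
      have hs' : (0 : ℝ) < s := hs
      have ht' : (0 : ℝ) < t := ht
      have hb : ‖y (t + s) - y (t + 0)‖ ≤ C * ‖(t + s) - (t + 0)‖ :=
        Convex.norm_image_sub_le_of_norm_hasDerivWithin_le (s := Ici 0) (f' := y')
          (fun x hx => (hy x hx).hasDerivWithinAt) hC (convex_Ici 0)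
          (by simpa using ht'.le) (by simpa using (add_pos ht' hs').le)
      have hs2 : ‖(t + s) - (t + 0)‖ = s := by
        rw [add_sub_add_left_eq_sub, sub_zero, Real.norm_of_nonneg hs'.le]
      rw [hs2] at hb
      rw [← mul_sub, norm_mul, norm_mul, norm_inv, Real.norm_of_nonneg hs'.le]
      calc s⁻¹ * (‖h t‖ * ‖y (t + s) - y (t + 0)‖) ≤ s⁻¹ * (‖h t‖ * (C * s)) := by gcongr
        _ = ‖h t‖ * C := by field_simp
    · filter_upwards [ae_restrict_mem measurableSet_Ioi] with t ht
      have ht' : (0 : ℝ) < t := ht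
      have hd : HasDerivAt (fun s => h t * y (t + s)) (h t * y' t) 0 := by
        have := hy (t + 0) (by simpa using ht'.le)
        simpa using (this.comp_const_add t 0).const_mul (h t)
      have := (hasDerivWithinAt_iff_tendsto_slope' self_notMem_Ioi).1
        (hd.hasDerivWithinAt (s := Ioi 0))
      exact this.congr fun s => by simp [slope_def_module]
  refine key.congr' ?_
  filter_upwards [self_mem_nhdsWithin] with s hs
  rw [integral_const_mul, integral_sub (hint s (le_of_lt hs)) (hint 0 le_rfl), slope_def_module]
  simp

theorem eq_of_hasDerivAt_linear {a y z : ℝ → ℝ} (ha : ContinuousOn a (Ici 0))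
    (hy : ∀ t, 0 ≤ t → HasDerivAt y (a t * y t) t) (hz : ∀ t, 0 ≤ t → HasDerivAt z (a t * z t) t)
    (h0 : y 0 = z 0) {t : ℝ} (ht : 0 ≤ t) : y t = z t := by
  obtain ⟨C, hC⟩ := isCompact_Icc.exists_bound_of_continuousOn
    (ha.mono (Icc_subset_Ici_self : Icc 0 t ⊆ Ici 0))
  refine ODE_solution_unique_of_mem_Icc_right (v := fun s x => a s * x) (s := fun _ => univ)
    (K := C.toNNReal) (a := 0) (b := t) (fun s hs => ?_)
    (fun s hs => (hy s hs.1).continuousAt.continuousWithinAt)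
    (fun s hs => (hy s hs.1).hasDerivWithinAt) (fun _ _ => mem_univ _)
    (fun s hs => (hz s hs.1).continuousAt.continuousWithinAt)
    (fun s hs => (hz s hs.1).hasDerivWithinAt) (fun _ _ => mem_univ _) h0 ⟨ht, le_rfl⟩
  refine LipschitzOnWith.of_dist_le_mul fun x _ x' _ => ?_
  rw [Real.dist_eq, Real.dist_eq, ← mul_sub, abs_mul]
  gcongr
  exact (hC s ⟨hs.1, hs.2.le⟩).trans (Real.le_coe_toNNReal C)

/-- Uniqueness of the trajectories of a `C¹` autonomous scalar equation staying in `N`. -/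
theorem eq_of_hasDerivAt_autonomous {b b' x y : ℝ → ℝ} {N : Set ℝ}
    (hb : ∀ k ∈ N, HasDerivAt b (b' k) k) (hb' : ContinuousOn b' N)
    (hx : ∀ t, 0 ≤ t → HasDerivAt x (b (x t)) t) (hy : ∀ t, 0 ≤ t → HasDerivAt y (b (y t)) t)
    (hxN : ∀ t, 0 ≤ t → x t ∈ N) (hyN : ∀ t, 0 ≤ t → y t ∈ N)
    (h0 : x 0 = y 0) {t : ℝ} (ht : 0 ≤ t) : x t = y t := by
  have hxc : ContinuousOn x (Icc 0 t) := fun s hs => (hx s hs.1).continuousAt.continuousWithinAt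
  have hyc : ContinuousOn y (Icc 0 t) := fun s hs => (hy s hs.1).continuousAt.continuousWithinAt
  set S : Set ℝ := x '' Icc 0 t ∪ y '' Icc 0 t
  have hSN : S ⊆ N := by
    rintro _ (⟨s, hs, rfl⟩ | ⟨s, hs, rfl⟩)
    exacts [hxN s hs.1, hyN s hs.1]
  have hSc : IsCompact S := (isCompact_Icc.image_of_continuousOn hxc).union
    (isCompact_Icc.image_of_continuousOn hyc)
  have h0m : (0 : ℝ) ∈ Icc 0 t := ⟨le_rfl, ht⟩
  have hSconv : Convex ℝ S :=
    (IsPreconnected.union (x 0) (mem_image_of_mem x h0m)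
      (h0 ▸ mem_image_of_mem y h0m) (isPreconnected_Icc.image _ hxc)
      (isPreconnected_Icc.image _ hyc)).ordConnected.convex
  obtain ⟨C, hC⟩ := hSc.exists_bound_of_continuousOn (hb'.mono hSN)
  have hlip : LipschitzOnWith C.toNNReal b S :=
    hSconv.lipschitzOnWith_of_nnnorm_hasDerivWithin_le
      (fun k hk => (hb k (hSN hk)).hasDerivWithinAt) (fun k hk => by
        rw [← NNReal.coe_le_coe, coe_nnnorm]
        exact (hC k hk).trans (Real.le_coe_toNNReal C))
  exact ODE_solution_unique_of_mem_Icc_right (v := fun _ => b) (s := fun _ => S) (a := 0) (b := t)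
    (fun _ _ => hlip) hxc (fun s hs => (hx s hs.1).hasDerivWithinAt)
    (fun s hs => Or.inl ⟨s, ⟨hs.1, hs.2.le⟩, rfl⟩) hyc
    (fun s hs => (hy s hs.1).hasDerivWithinAt)
    (fun s hs => Or.inr ⟨s, ⟨hs.1, hs.2.le⟩, rfl⟩) h0 ⟨ht, le_rfl⟩

theorem hasDerivWithinAt_discounted_trajectory {h v v' b x : ℝ → ℝ} {N : Set ℝ} {L : ℝ}
    (hN : IsOpen N) (hL : L ∈ N) (hh : IntegrableOn h (Ioi 0))
    (hv : ∀ k ∈ N, HasDerivAt v (v' k) k) (hv' : ContinuousOn v' N) (hb : ContinuousOn b N)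
    (hx : ∀ t, 0 ≤ t → HasDerivAt x (b (x t)) t) (hxN : ∀ t, 0 ≤ t → x t ∈ N)
    (hxL : Tendsto x atTop (nhds L))
    (hint : ∀ s, 0 ≤ s → IntegrableOn (fun t => h t * v (x (t + s))) (Ioi 0)) :
    IntegrableOn (fun t => h t * (v' (x t) * b (x t))) (Ioi 0) ∧
    HasDerivWithinAt (fun s => ∫ t in Ioi 0, h t * v (x (t + s)))
      (∫ t in Ioi 0, h t * (v' (x t) * b (x t))) (Ici 0) 0 := by
  have hxc : ContinuousOn x (Ici 0) := fun t ht => (hx t ht).continuousAt.continuousWithinAt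
  have hc : ContinuousOn (fun t => v' (x t) * b (x t)) (Ici 0) :=
    (hv'.mul hb).comp hxc hxN
  have hlim : Tendsto (fun t => v' (x t) * b (x t)) atTop (nhds (v' L * b L)) :=
    ((hv'.mul hb).continuousAt (hN.mem_nhds hL)).tendsto.comp hxL
  obtain ⟨C, hC⟩ := exists_abs_le_of_continuousOn_of_tendsto hc hlim
  refine ⟨Integrable.mul_bdd (c := C) hh
    ((hc.mono Ioi_subset_Ici_self).aestronglyMeasurable measurableSet_Ioi) ?_,
    hasDerivWithinAt_integral_mul_shift (y := fun t => v (x t)) hh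
      (fun t ht => (hv _ (hxN t ht)).comp t (hx t ht)) hC hint⟩
  filter_upwards [ae_restrict_mem measurableSet_Ioi] with t ht
  exact hC t (le_of_lt ht)

section PartialDerivatives

variable {u : ℝ → ℝ → ℝ}

theorem hasDerivAt_comp_curve
    (hu : ContDiffOn ℝ (⊤ : ℕ∞) (fun p : ℝ × ℝ => u p.1 p.2) (Ioi 0 ×ˢ Ioi 0))
    {p q : ℝ → ℝ} {p' q' s : ℝ} (hp : HasDerivAt p p' s) (hq : HasDerivAt q q' s)
    (hp0 : 0 < p s) (hq0 : 0 < q s) :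
    HasDerivAt (fun s => u (p s) (q s))
      (fderiv ℝ (fun p : ℝ × ℝ => u p.1 p.2) (p s, q s) (p', q')) s := by
  have hm : (p s, q s) ∈ Ioi (0 : ℝ) ×ˢ Ioi (0 : ℝ) := ⟨hp0, hq0⟩
  have hd : HasFDerivAt (fun p : ℝ × ℝ => u p.1 p.2) _ (p s, q s) :=
    ((hu.contDiffAt ((isOpen_Ioi.prod isOpen_Ioi).mem_nhds hm)).differentiableAt
      (by simp)).hasFDerivAt
  exact HasFDerivAt.comp_hasDerivAt (f := fun s => (p s, q s)) s hd (hp.prodMk hq)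

theorem pd1_eq_fderiv
    (hu : ContDiffOn ℝ (⊤ : ℕ∞) (fun p : ℝ × ℝ => u p.1 p.2) (Ioi 0 ×ˢ Ioi 0)) {c k : ℝ}
    (hc : 0 < c) (hk : 0 < k) :
    pd1 u c k = fderiv ℝ (fun p : ℝ × ℝ => u p.1 p.2) (c, k) (1, 0) :=
  (hasDerivAt_comp_curve hu (hasDerivAt_id c) (hasDerivAt_const c k) hc hk).deriv

theorem pd2_eq_fderiv
    (hu : ContDiffOn ℝ (⊤ : ℕ∞) (fun p : ℝ × ℝ => u p.1 p.2) (Ioi 0 ×ˢ Ioi 0)) {c k : ℝ}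
    (hc : 0 < c) (hk : 0 < k) :
    pd2 u c k = fderiv ℝ (fun p : ℝ × ℝ => u p.1 p.2) (c, k) (0, 1) :=
  (hasDerivAt_comp_curve hu (hasDerivAt_const k c) (hasDerivAt_id k) hc hk).deriv

theorem hasDerivAt_pd1
    (hu : ContDiffOn ℝ (⊤ : ℕ∞) (fun p : ℝ × ℝ => u p.1 p.2) (Ioi 0 ×ˢ Ioi 0)) {c k : ℝ}
    (hc : 0 < c) (hk : 0 < k) : HasDerivAt (fun x => u x k) (pd1 u c k) c :=
  (hasDerivAt_comp_curve hu (hasDerivAt_id c)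
    (hasDerivAt_const c k) hc hk).differentiableAt.hasDerivAt

theorem hasDerivAt_along_strategy
    (hu : ContDiffOn ℝ (⊤ : ℕ∞) (fun p : ℝ × ℝ => u p.1 p.2) (Ioi 0 ×ˢ Ioi 0))
    {σ : ℝ → ℝ} {σ' k : ℝ} (hσ : HasDerivAt σ σ' k) (hc : 0 < σ k) (hk : 0 < k) :
    HasDerivAt (fun y => u (σ y) y) (pd1 u (σ k) k * σ' + pd2 u (σ k) k) k := by
  have h := hasDerivAt_comp_curve hu hσ (hasDerivAt_id k) hc hk
  have e : ((σ', 1) : ℝ × ℝ) = σ' • (1, 0) + (0, 1) := by simp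
  rw [e, map_add, map_smul, id, ← pd1_eq_fderiv hu hc hk, ← pd2_eq_fderiv hu hc hk, smul_eq_mul,
    mul_comm] at h
  exact h

theorem continuousOn_fderiv_quadrant
    (hu : ContDiffOn ℝ (⊤ : ℕ∞) (fun p : ℝ × ℝ => u p.1 p.2) (Ioi 0 ×ˢ Ioi 0)) :
    ContinuousOn (fderiv ℝ (fun p : ℝ × ℝ => u p.1 p.2)) (Ioi 0 ×ˢ Ioi 0) :=
  hu.continuousOn_fderiv_of_isOpen (isOpen_Ioi.prod isOpen_Ioi) (by simp)

theorem continuousOn_pd1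
    (hu : ContDiffOn ℝ (⊤ : ℕ∞) (fun p : ℝ × ℝ => u p.1 p.2) (Ioi 0 ×ˢ Ioi 0)) :
    ContinuousOn (fun p : ℝ × ℝ => pd1 u p.1 p.2) (Ioi 0 ×ˢ Ioi 0) :=
  ((continuousOn_fderiv_quadrant hu).clm_apply continuousOn_const).congr
    fun _ hp => pd1_eq_fderiv hu hp.1 hp.2

theorem continuousOn_pd2
    (hu : ContDiffOn ℝ (⊤ : ℕ∞) (fun p : ℝ × ℝ => u p.1 p.2) (Ioi 0 ×ˢ Ioi 0)) :
    ContinuousOn (fun p : ℝ × ℝ => pd2 u p.1 p.2) (Ioi 0 ×ˢ Ioi 0) :=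
  ((continuousOn_fderiv_quadrant hu).clm_apply continuousOn_const).congr
    fun _ hp => pd2_eq_fderiv hu hp.1 hp.2

theorem strictAntiOn_pd1
    (hu : ContDiffOn ℝ (⊤ : ℕ∞) (fun p : ℝ × ℝ => u p.1 p.2) (Ioi 0 ×ˢ Ioi 0)) {k : ℝ}
    (hk : 0 < k) (h11 : ∀ c > (0 : ℝ), pd11 u c k < 0) :
    StrictAntiOn (fun c => pd1 u c k) (Ioi 0) :=
  strictAntiOn_of_deriv_neg (convex_Ioi 0)
    ((continuousOn_pd1 hu).comp (f := fun c : ℝ => (c, k)) (by fun_prop) fun _ hc => ⟨hc, hk⟩)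
    fun c hc => h11 c (interior_subset hc)

theorem pd1_pos
    (hu : ContDiffOn ℝ (⊤ : ℕ∞) (fun p : ℝ × ℝ => u p.1 p.2) (Ioi 0 ×ˢ Ioi 0)) {c k : ℝ}
    (hc : 0 < c) (hk : 0 < k) (h11 : ∀ c > (0 : ℝ), pd11 u c k < 0)
    (hm : StrictMonoOn (fun c => u c k) (Ioi 0)) : 0 < pd1 u c k := by
  have hc1 : 0 < c + 1 := by linarith
  have hd := (hasDerivAt_pd1 hu hc1 hk).hasDerivWithinAt (s := Ioi 0)
  have h0 : 0 ≤ pd1 u (c + 1) k := by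
    rw [← hd.derivWithin (isOpen_Ioi.uniqueDiffWithinAt hc1)]
    exact hm.monotoneOn.derivWithin_nonneg
  exact h0.trans_lt (strictAntiOn_pd1 hu hk h11 hc hc1 (lt_add_one c))

end PartialDerivatives

/-- First-order condition: at an equilibrium the marginal utility of consumption equals the
marginal value of capital transported by the linearized flow. -/
theorem marginal_utility_eq_integral {u U : ℝ → ℝ → ℝ} {h H σ : ℝ → ℝ} {K R : ℝ → ℝ → ℝ} {k : ℝ}
    (hu : ContDiffOn ℝ (⊤ : ℕ∞) (fun p : ℝ × ℝ => u p.1 p.2) (Ioi 0 ×ˢ Ioi 0))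
    (hU : ContDiffOn ℝ (⊤ : ℕ∞) (fun p : ℝ × ℝ => U p.1 p.2) (Ioi 0 ×ˢ Ioi 0))
    (hk : 0 < k) (hσ : 0 < σ k)
    (hEq : ∀ c > (0 : ℝ), Pval u U h H σ K R k c ≤ Pval u U h H σ K R k (σ k)) :
    pd1 u (σ k) k + pd1 U (σ k) k = ∫ t in Ioi (0 : ℝ),
      (h t * (pd1 u (σ (K t k)) (K t k) * deriv σ (K t k) + pd2 u (σ (K t k)) (K t k)) +
       H t * (pd1 U (σ (K t k)) (K t k) * deriv σ (K t k) + pd2 U (σ (K t k)) (K t k))) * R k t := by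
  set A := ∫ t in Ioi (0 : ℝ),
      (h t * (pd1 u (σ (K t k)) (K t k) * deriv σ (K t k) + pd2 u (σ (K t k)) (K t k)) +
       H t * (pd1 U (σ (K t k)) (K t k) * deriv σ (K t k) + pd2 U (σ (K t k)) (K t k))) * R k t
  have hP : Pval u U h H σ K R k = fun c =>
      u c k - u (σ k) k + (U c k - U (σ k) k) + A * (σ k - c) := by
    funext c
    simp only [Pval, ← mul_assoc]
    rw [integral_mul_const]
  have hd : HasDerivAt (Pval u U h H σ K R k)
      (pd1 u (σ k) k + pd1 U (σ k) k + A * (0 - 1)) (σ k) := by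
    rw [hP]
    exact (((hasDerivAt_pd1 hu hσ hk).sub_const _).add ((hasDerivAt_pd1 hU hσ hk).sub_const _)).add
      (((hasDerivAt_const _ _).sub (hasDerivAt_id _)).const_mul A)
  have hmax : IsLocalMax (Pval u U h H σ K R k) (σ k) := by
    filter_upwards [Ioi_mem_nhds hσ] with c hc using hEq c hc
  linarith [hmax.hasDerivAt_eq_zero hd]

/-- Necessity: the integral equation for equilibrium strategies.
If `σ` is an equilibrium strategy converging to `kinf` on `N` and the value function `V`
is well defined and differentiable on `N`, then `u₁'(σ(k₀),k₀) + U₁'(σ(k₀),k₀) = V'(k₀)`,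
hence `σ(k₀) = φ(V'(k₀),k₀)`, and `V` satisfies the integral equation (IE). -/
theorem stmt_4
    (f : ℝ → ℝ) (u U : ℝ → ℝ → ℝ) (h H : ℝ → ℝ)
    (hf_conc : ConcaveOn ℝ (Set.Ici 0) f)
    (hf_cont : ContinuousOn f (Set.Ici 0))
    (hf_smooth : ContDiffOn ℝ (⊤ : ℕ∞) f (Set.Ioi 0))
    (hf_inada0 : Tendsto (deriv f) (nhdsWithin 0 (Set.Ioi 0)) atTop)
    (hf_inada1 : ∃ L ≤ (0:ℝ), Tendsto (deriv f) atTop (nhds L))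
    (hu_smooth : ContDiffOn ℝ (⊤ : ℕ∞) (fun p : ℝ × ℝ => u p.1 p.2) (Set.Ioi 0 ×ˢ Set.Ioi 0))
    (hU_smooth : ContDiffOn ℝ (⊤ : ℕ∞) (fun p : ℝ × ℝ => U p.1 p.2) (Set.Ioi 0 ×ˢ Set.Ioi 0))
    (hu_mono : ∀ k > (0:ℝ), StrictMonoOn (fun c => u c k) (Set.Ioi 0))
    (hU_mono : ∀ k > (0:ℝ), StrictMonoOn (fun c => U c k) (Set.Ioi 0))
    (hu11 : ∀ c > (0:ℝ), ∀ k > (0:ℝ), pd11 u c k < 0)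
    (hU11 : ∀ c > (0:ℝ), ∀ k > (0:ℝ), pd11 U c k < 0)
    (hh_smooth : ContDiffOn ℝ (⊤ : ℕ∞) h (Set.Ici 0))
    (hH_smooth : ContDiffOn ℝ (⊤ : ℕ∞) H (Set.Ici 0))
    (hh_anti : AntitoneOn h (Set.Ici 0)) (hH_anti : AntitoneOn H (Set.Ici 0))
    (hh0 : h 0 = 1) (hH0 : H 0 = 1)
    (hh_lim : Tendsto h atTop (nhds 0)) (hH_lim : Tendsto H atTop (nhds 0))
    (hdecay : ∃ ρ > (0:ℝ), ∃ T > (0:ℝ), ∀ t ≥ T,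
      h t ≤ Real.exp (-ρ * t) ∧ H t ≤ Real.exp (-ρ * t))
    -- the implicit function φ : u₁'(φ(x,k),k) + U₁'(φ(x,k),k) = x
    (φ : ℝ → ℝ → ℝ)
    (hφ : ∀ k > (0:ℝ), ∀ x > (0:ℝ),
      0 < φ x k ∧ pd1 u (φ x k) k + pd1 U (φ x k) k = x)
    -- σ is a convergent Markov strategy on N, with flow K and linearized flow R
    (N : Set ℝ) (hNopen : IsOpen N) (hNpos : N ⊆ Set.Ioi 0)
    (kinf : ℝ) (hkinfN : kinf ∈ N)
    (σ : ℝ → ℝ) (hσC1 : ContDiffOn ℝ 1 σ N) (hσpos : ∀ k ∈ N, 0 < σ k)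
    (K R : ℝ → ℝ → ℝ)
    (hK0 : ∀ k₀ ∈ N, K 0 k₀ = k₀)
    (hKode : ∀ k₀ ∈ N, ∀ t : ℝ, 0 ≤ t →
      HasDerivAt (fun s => K s k₀) (f (K t k₀) - σ (K t k₀)) t)
    (hKstay : ∀ k₀ ∈ N, ∀ t : ℝ, 0 ≤ t → K t k₀ ∈ N)
    (hKconv : ∀ k₀ ∈ N, Tendsto (fun t => K t k₀) atTop (nhds kinf))
    (hR0 : ∀ k₀ ∈ N, R k₀ 0 = 1)
    (hRode : ∀ k₀ ∈ N, ∀ t : ℝ, 0 ≤ t →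
      HasDerivAt (R k₀) ((deriv f (K t k₀) - deriv σ (K t k₀)) * R k₀ t) t)
    -- σ is an equilibrium strategy
    (hEq : ∀ k ∈ N, ∀ c > (0:ℝ),
      Pval u U h H σ K R k c ≤ Pval u U h H σ K R k (σ k))
    -- the value function V, well defined and differentiable on N
    (V : ℝ → ℝ)
    (hVint : ∀ k₀ ∈ N,
      IntegrableOn (fun t => h t * u (σ (K t k₀)) (K t k₀)) (Set.Ioi 0) ∧
      IntegrableOn (fun t => H t * U (σ (K t k₀)) (K t k₀)) (Set.Ioi 0))
    (hVdef : ∀ k₀ ∈ N, V k₀ =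
      (∫ t in Set.Ioi (0:ℝ), h t * u (σ (K t k₀)) (K t k₀)) +
      ∫ t in Set.Ioi (0:ℝ), H t * U (σ (K t k₀)) (K t k₀))
    (hVdiff : DifferentiableOn ℝ V N) :
    ∀ k₀ ∈ N,
      pd1 u (σ k₀) k₀ + pd1 U (σ k₀) k₀ = deriv V k₀ ∧
      σ k₀ = φ (deriv V k₀) k₀ ∧
      V k₀ =
        (∫ t in Set.Ioi (0:ℝ),
          h t * u (φ (deriv V (K t k₀)) (K t k₀)) (K t k₀)) +
        ∫ t in Set.Ioi (0:ℝ),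
          H t * U (φ (deriv V (K t k₀)) (K t k₀)) (K t k₀) := by
  have hbd : ∀ k ∈ N, HasDerivAt (fun k => f k - σ k) (deriv f k - deriv σ k) k := fun k hk =>
    ((hf_smooth.contDiffAt (Ioi_mem_nhds (hNpos hk))).differentiableAt (by simp)).hasDerivAt.sub
      ((hσC1.contDiffAt (hNopen.mem_nhds hk)).differentiableAt one_ne_zero).hasDerivAt
  have hσd : ∀ k ∈ N, HasDerivAt σ (deriv σ k) k := fun k hk =>
    ((hσC1.contDiffAt (hNopen.mem_nhds hk)).differentiableAt one_ne_zero).hasDerivAt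
  have hσ'c : ContinuousOn (deriv σ) N := hσC1.continuousOn_deriv_of_isOpen hNopen le_rfl
  have hb'c : ContinuousOn (fun k => deriv f k - deriv σ k) N :=
    ((hf_smooth.continuousOn_deriv_of_isOpen isOpen_Ioi (by simp)).mono hNpos).sub hσ'c
  have hbc : ContinuousOn (fun k => f k - σ k) N :=
    fun k hk => (hbd k hk).continuousAt.continuousWithinAt
  have hpair : ContinuousOn (fun k => (σ k, k)) N := hσC1.continuousOn.prodMk continuousOn_id
  have hmaps : MapsTo (fun k => (σ k, k)) N (Ioi 0 ×ˢ Ioi 0) := fun k hk => ⟨hσpos k hk, hNpos hk⟩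
  have hgc : ContinuousOn (fun k => pd1 u (σ k) k + pd1 U (σ k) k) N :=
    ((continuousOn_pd1 hu_smooth).comp hpair hmaps).add
      ((continuousOn_pd1 hU_smooth).comp hpair hmaps)
  have hvc : ContinuousOn (fun k => pd1 u (σ k) k * deriv σ k + pd2 u (σ k) k) N :=
    (((continuousOn_pd1 hu_smooth).comp hpair hmaps).mul hσ'c).add
      ((continuousOn_pd2 hu_smooth).comp hpair hmaps)
  have hwc : ContinuousOn (fun k => pd1 U (σ k) k * deriv σ k + pd2 U (σ k) k) N :=
    (((continuousOn_pd1 hU_smooth).comp hpair hmaps).mul hσ'c).add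
      ((continuousOn_pd2 hU_smooth).comp hpair hmaps)
  obtain ⟨ρ, hρ, T, -, hdec⟩ := hdecay
  have hhint : IntegrableOn h (Ioi 0) := integrableOn_of_antitoneOn_of_le_exp
    hh_smooth.continuousOn hh_anti hh_lim hρ fun t ht => (hdec t ht).1
  have hHint : IntegrableOn H (Ioi 0) := integrableOn_of_antitoneOn_of_le_exp
    hH_smooth.continuousOn hH_anti hH_lim hρ fun t ht => (hdec t ht).2
  have hflow : ∀ k ∈ N, ∀ s, 0 ≤ s → ∀ t, 0 ≤ t → K t (K s k) = K (t + s) k := by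
    intro k hk s hs t ht
    have hks := hKstay k hk s hs
    exact eq_of_hasDerivAt_autonomous (y := fun t => K (t + s) k) hbd hb'c (hKode _ hks)
      (fun r hr => (hKode k hk (r + s) (add_nonneg hr hs)).comp_add_const r s)
      (hKstay _ hks) (fun r hr => hKstay k hk (r + s) (add_nonneg hr hs))
      (by simp [hK0 _ hks]) ht
  have hR : ∀ k ∈ N, ∀ t, 0 ≤ t → f (K t k) - σ (K t k) = R k t * (f k - σ k) := by
    intro k hk t ht
    refine eq_of_hasDerivAt_linear (a := fun t => deriv f (K t k) - deriv σ (K t k))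
      (y := fun t => f (K t k) - σ (K t k)) (z := fun t => R k t * (f k - σ k))
      (hb'c.comp (fun s hs => (hKode k hk s hs).continuousAt.continuousWithinAt) (hKstay k hk))
      (fun s hs => HasDerivAt.comp (h := fun t => K t k) s (hbd _ (hKstay k hk s hs))
        (hKode k hk s hs)) (fun s hs => ?_) ?_ ht
    · have := (hRode k hk s hs).mul_const (f k - σ k)
      rwa [mul_assoc] at this
    · simp [hK0 k hk, hR0 k hk]
  have hrest : ∀ k ∈ N, f k - σ k = 0 → k = kinf := by
    intro k hk hb
    have hconst : ∀ t, 0 ≤ t → K t k = k := fun t ht =>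
      eq_of_hasDerivAt_linear (a := fun _ => 0) (y := fun t => K t k) (z := fun _ => k)
        continuousOn_const
        (fun s hs => by simpa [hR k hk s hs, hb] using hKode k hk s hs)
        (fun s _ => by simpa using hasDerivAt_const s k) (hK0 k hk) ht
    exact tendsto_nhds_unique (tendsto_const_nhds.congr'
      ((eventually_ge_atTop 0).mono fun t ht => (hconst t ht).symm)) (hKconv k hk)
  have hVd : ∀ k ∈ N, HasDerivAt V (deriv V k) k := fun k hk =>
    (hVdiff.differentiableAt (hNopen.mem_nhds hk)).hasDerivAt
  have hne : ∀ k ∈ N, k ≠ kinf → deriv V k = pd1 u (σ k) k + pd1 U (σ k) k := by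
    intro k hk hkne
    have hb : f k - σ k ≠ 0 := fun h0 => hkne (hrest k hk h0)
    have hshift_u : ∀ s, 0 ≤ s → IntegrableOn
        (fun t => h t * u (σ (K (t + s) k)) (K (t + s) k)) (Ioi 0) := fun s hs =>
      (hVint _ (hKstay k hk s hs)).1.congr_fun
        (fun t ht => by simp only [hflow k hk s hs t (le_of_lt ht)]) measurableSet_Ioi
    have hshift_U : ∀ s, 0 ≤ s → IntegrableOn
        (fun t => H t * U (σ (K (t + s) k)) (K (t + s) k)) (Ioi 0) := fun s hs =>
      (hVint _ (hKstay k hk s hs)).2.congr_fun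
        (fun t ht => by simp only [hflow k hk s hs t (le_of_lt ht)]) measurableSet_Ioi
    obtain ⟨hi1, hd1⟩ := hasDerivWithinAt_discounted_trajectory (x := fun t => K t k)
      (v := fun k => u (σ k) k) hNopen hkinfN hhint
      (fun k hk => hasDerivAt_along_strategy hu_smooth (hσd k hk) (hσpos k hk) (hNpos hk))
      hvc hbc (hKode k hk) (hKstay k hk) (hKconv k hk) hshift_u
    obtain ⟨hi2, hd2⟩ := hasDerivWithinAt_discounted_trajectory (x := fun t => K t k)
      (v := fun k => U (σ k) k) hNopen hkinfN hHint
      (fun k hk => hasDerivAt_along_strategy hU_smooth (hσd k hk) (hσpos k hk) (hNpos hk))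
      hwc hbc (hKode k hk) (hKstay k hk) (hKconv k hk) hshift_U
    have hVK : ∀ s ∈ Ici (0 : ℝ), V (K s k) =
        (∫ t in Ioi (0 : ℝ), h t * u (σ (K (t + s) k)) (K (t + s) k)) +
        ∫ t in Ioi (0 : ℝ), H t * U (σ (K (t + s) k)) (K (t + s) k) := by
      intro s hs
      rw [hVdef _ (hKstay k hk s hs)]
      congr 1 <;>
      exact setIntegral_congr_fun measurableSet_Ioi
        fun t ht => by simp only [hflow k hk s hs t (le_of_lt ht)]
    have hd := (hd1.add hd2).congr hVK (hVK 0 self_mem_Ici)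
    have hchain : HasDerivAt (fun s => V (K s k)) (deriv V k * (f k - σ k)) 0 := by
      have h1 := hKode k hk 0 le_rfl
      have h2 := hVd k hk
      rw [← hK0 k hk] at h2
      have h3 := h2.comp 0 h1
      rwa [hK0 k hk] at h3
    have heq := (uniqueDiffOn_Ici (0 : ℝ) 0 self_mem_Ici).eq_deriv _ hchain.hasDerivWithinAt hd
    rw [← integral_add hi1 hi2] at heq
    refine mul_right_cancel₀ hb (heq.trans ?_)
    rw [marginal_utility_eq_integral hu_smooth hU_smooth (hNpos hk) (hσpos k hk) (hEq k hk),
      ← integral_mul_const]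
    refine setIntegral_congr_fun measurableSet_Ioi fun t ht => ?_
    simp only [hR k hk t (le_of_lt ht)]
    ring
  have hmarg : ∀ k ∈ N, pd1 u (σ k) k + pd1 U (σ k) k = deriv V k := by
    intro k hk
    by_cases hkk : k = kinf
    · subst hkk
      have hev : ∀ᶠ y in nhdsWithin k (Ioi k), pd1 u (σ y) y + pd1 U (σ y) y = deriv V y := by
        filter_upwards [mem_nhdsWithin_of_mem_nhds (hNopen.mem_nhds hk), self_mem_nhdsWithin]
          with y hy hy' using (hne y hy (ne_of_gt hy')).symm
      have hlim : Tendsto (deriv V) (nhdsWithin k (Ioi k))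
          (nhds (pd1 u (σ k) k + pd1 U (σ k) k)) :=
        ((hgc.continuousAt (hNopen.mem_nhds hk)).tendsto.mono_left nhdsWithin_le_nhds).congr' hev
      have hd := hasDerivWithinAt_Ici_of_tendsto_deriv hVdiff
        (hVd k hk).continuousAt.continuousWithinAt
        (mem_nhdsWithin_of_mem_nhds (hNopen.mem_nhds hk)) hlim
      exact (uniqueDiffOn_Ici k k self_mem_Ici).eq_deriv _ hd (hVd k hk).hasDerivWithinAt
    · exact (hne k hk hkk).symm
  have hσφ : ∀ k ∈ N, σ k = φ (deriv V k) k := by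
    intro k hk
    have hk0 : 0 < k := hNpos hk
    have hpos : 0 < deriv V k := by
      rw [← hmarg k hk]
      exact add_pos
        (pd1_pos hu_smooth (hσpos k hk) hk0 (fun c hc => hu11 c hc k hk0) (hu_mono k hk0))
        (pd1_pos hU_smooth (hσpos k hk) hk0 (fun c hc => hU11 c hc k hk0) (hU_mono k hk0))
    obtain ⟨hφpos, hφeq⟩ := hφ k hk0 _ hpos
    exact ((strictAntiOn_pd1 hu_smooth hk0 fun c hc => hu11 c hc k hk0).add
      (strictAntiOn_pd1 hU_smooth hk0 fun c hc => hU11 c hc k hk0)).injOn (hσpos k hk) hφpos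
      ((hmarg k hk).trans hφeq.symm)
  intro k₀ hk₀
  refine ⟨hmarg k₀ hk₀, hσφ k₀ hk₀, ?_⟩
  rw [hVdef k₀ hk₀]
  congr 1 <;>
  exact setIntegral_congr_fun measurableSet_Ioi
    fun t ht => by simp only [← hσφ _ (hKstay k₀ hk₀ t (le_of_lt ht))]
end

section
/- (Equivalence of the integral equation and the integro-differential equation) Let V be a C² function on a neighborhood N of k̄ such that the strategy σ(k):=φ(V′(k),k) is convergent to k̄ on N. Then V satisfies the integral equation (IE): V(k₀) = ∫₀^∞ h(t)·u(σ(K_t),K_t) dt + ∫₀^∞ H(t)·U(σ(K_t),K_t) dt for all k₀∈N (where K_t = K(t;k₀,σ)) if and only if V satisfies the integro-differential equation (DE): u(σ(k₀),k₀) + U(σ(k₀),k₀) + V′(k₀)·(f(k₀) − σ(k₀)) = −∫₀^∞ h′(t)·u(σ(K_t),K_t) dt − ∫₀^∞ H′(t)·U(σ(K_t),K_t) dt for all k₀∈N, together with the boundary condition (BC): V(k̄) = u(f(k̄),k̄)·∫₀^∞ h(t) dt + U(f(k̄),k̄)·∫₀^∞ H(t) dt. -/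
open MeasureTheory Filter Set

open scoped Topology

/-- Solutions in `N` of an autonomous ODE with locally Lipschitz right-hand side are determined
by their initial value. -/
lemma autonomous_ode_unique {v : ℝ → ℝ} {N : Set ℝ} (hv : LocallyLipschitzOn N v)
    {x y : ℝ → ℝ} (hx : ∀ t, 0 ≤ t → HasDerivAt x (v (x t)) t)
    (hy : ∀ t, 0 ≤ t → HasDerivAt y (v (y t)) t)
    (hxN : ∀ t, 0 ≤ t → x t ∈ N) (hyN : ∀ t, 0 ≤ t → y t ∈ N) (h0 : x 0 = y 0)
    {t : ℝ} (ht : 0 ≤ t) : x t = y t := by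
  have hxc : ContinuousOn x (Icc 0 t) := HasDerivAt.continuousOn fun s hs => hx s hs.1
  have hyc : ContinuousOn y (Icc 0 t) := HasDerivAt.continuousOn fun s hs => hy s hs.1
  have hsub : x '' Icc 0 t ∪ y '' Icc 0 t ⊆ N := by
    rintro _ (⟨s, hs, rfl⟩ | ⟨s, hs, rfl⟩)
    exacts [hxN s hs.1, hyN s hs.1]
  obtain ⟨L, hL⟩ := (hv.mono hsub).exists_lipschitzOnWith_of_compact
    ((isCompact_Icc.image_of_continuousOn hxc).union (isCompact_Icc.image_of_continuousOn hyc))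
  exact ODE_solution_unique_of_mem_Icc_right (v := fun _ => v) (fun _ _ => hL)
    hxc (fun s hs => (hx s hs.1).hasDerivWithinAt)
    (fun s hs => Or.inl (mem_image_of_mem x (Ico_subset_Icc_self hs)))
    hyc (fun s hs => (hy s hs.1).hasDerivWithinAt)
    (fun s hs => Or.inr (mem_image_of_mem y (Ico_subset_Icc_self hs))) h0 (right_mem_Icc.2 ht)

lemma contDiffOn_locallyLipschitzOn_of_isOpen {v : ℝ → ℝ} {N : Set ℝ} (hN : IsOpen N)
    (hv : ContDiffOn ℝ 1 v N) : LocallyLipschitzOn N v := by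
  intro x hx
  obtain ⟨L, t, ht, hL⟩ := (hv.contDiffAt (hN.mem_nhds hx)).exists_lipschitzOnWith
  exact ⟨L, t, mem_nhdsWithin_of_mem_nhds ht, hL⟩

lemma exists_bound_of_continuousOn_Ici_of_tendsto {m : ℝ → ℝ} {l : ℝ}
    (hm : ContinuousOn m (Ici 0)) (hl : Tendsto m atTop (𝓝 l)) :
    ∃ B, ∀ t, 0 ≤ t → |m t| ≤ B := by
  obtain ⟨T, hT⟩ := eventually_atTop.1 (hl.abs.eventually (gt_mem_nhds (lt_add_one |l|)))
  obtain ⟨C, hC⟩ := (isCompact_Icc (a := (0 : ℝ)) (b := T)).exists_bound_of_continuousOn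
    (hm.mono Icc_subset_Ici_self)
  refine ⟨max C (|l| + 1), fun t ht => ?_⟩
  rcases le_total t T with h | h
  · exact (hC t ⟨ht, h⟩).trans (le_max_left _ _)
  · exact (hT t h).le.trans (le_max_right _ _)

/-- If a function and its derivative both converge at infinity, the derivative tends to zero. -/
lemma eq_zero_of_tendsto_of_tendsto_deriv {x x' : ℝ → ℝ} {a l : ℝ}
    (hx : ∀ t, 0 ≤ t → HasDerivAt x (x' t) t) (ha : Tendsto x atTop (𝓝 a))
    (hl : Tendsto x' atTop (𝓝 l)) : l = 0 := by
  have hex : ∀ t : ℝ, ∃ c, t ≤ c ∧ (0 ≤ t → x' c = x (t + 1) - x t) := by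
    intro t
    by_cases ht : 0 ≤ t
    · obtain ⟨c, hc, h⟩ := exists_hasDerivAt_eq_slope x x' (lt_add_one t)
        (HasDerivAt.continuousOn fun s hs => hx s (ht.trans hs.1))
        (fun s hs => hx s (ht.trans hs.1.le))
      exact ⟨c, hc.1.le, fun _ => by simpa using h⟩
    · exact ⟨t, le_rfl, fun h => absurd h ht⟩
  choose c hc hxc using hex
  have h1 : Tendsto (fun t => x' (c t)) atTop (𝓝 l) := hl.comp (tendsto_atTop_mono hc tendsto_id)
  have h2 : Tendsto (fun t => x (t + 1) - x t) atTop (𝓝 (a - a)) :=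
    (ha.comp (tendsto_atTop_add_const_right _ 1 tendsto_id)).sub ha
  rw [sub_self] at h2
  refine tendsto_nhds_unique (h1.congr' ?_) h2
  filter_upwards [eventually_ge_atTop 0] with t ht using hxc t ht

/-- A `C¹` function on `[0, ∞)` extends to a `C¹` function on the line with constant derivative
on the negative half-line. -/
lemma exists_hasDerivAt_extension {m m' : ℝ → ℝ} (hm : ∀ t, 0 ≤ t → HasDerivAt m (m' t) t)
    (hm' : ContinuousOn m' (Ici 0)) :
    ∃ M : ℝ → ℝ, (∀ t, HasDerivAt M (m' (max t 0)) t) ∧ (∀ t, 0 ≤ t → M t = m t) := by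
  have hc : Continuous fun t : ℝ => m' (max t 0) :=
    hm'.comp_continuous (by fun_prop) fun t => le_max_right t 0
  refine ⟨fun t => m 0 + ∫ r in (0 : ℝ)..t, m' (max r 0), fun t => ?_, fun t ht => ?_⟩
  · exact (intervalIntegral.integral_hasDerivAt_right (hc.intervalIntegrable _ _)
      hc.stronglyMeasurable.stronglyMeasurableAtFilter hc.continuousAt).const_add _
  · have : ∫ r in (0 : ℝ)..t, m' (max r 0) = m t - m 0 := by
      refine intervalIntegral.integral_eq_sub_of_hasDerivAt (fun r hr => ?_)
        (hc.intervalIntegrable _ _)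
      rw [uIcc_of_le ht] at hr
      rw [max_eq_left hr.1]
      exact hm r hr.1
    simp [this]

/-- Regularity of a discount factor that is used when differentiating discounted integrals. -/
structure IsDiscountFactor (h : ℝ → ℝ) : Prop where
  hasDerivAt : ∀ t, 0 < t → HasDerivAt h (deriv h t) t
  continuousWithinAt : ContinuousWithinAt h (Ici 0) 0
  zero : h 0 = 1
  tendsto : Tendsto h atTop (𝓝 0)
  integrableOn : IntegrableOn h (Ioi 0)
  integrableOn_deriv : IntegrableOn (deriv h) (Ioi 0)

lemma isDiscountFactor_of_le_exp {h : ℝ → ℝ} (hs : ContDiffOn ℝ (⊤ : ℕ∞) h (Ici 0))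
    (ha : AntitoneOn h (Ici 0)) (h0 : h 0 = 1) (hlim : Tendsto h atTop (𝓝 0))
    {ρ T : ℝ} (hρ : 0 < ρ) (hT : 0 < T) (hd : ∀ t ≥ T, h t ≤ Real.exp (-ρ * t)) :
    IsDiscountFactor h := by
  have hder : ∀ t, 0 < t → HasDerivAt h (deriv h t) t := fun t ht =>
    ((hs.differentiableOn (by simp)).differentiableAt (Ici_mem_nhds ht)).hasDerivAt
  have hnn : ∀ t, 0 ≤ t → 0 ≤ h t := fun t ht => by
    refine le_of_tendsto hlim ?_
    filter_upwards [eventually_ge_atTop t] with s hts using ha ht (ht.trans hts) hts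
  have hneg : ∀ t ∈ Ioi (0 : ℝ), deriv h t ≤ 0 := fun t ht => by
    rw [← derivWithin_of_mem_nhds (Ici_mem_nhds ht)]
    exact ha.derivWithin_nonpos
  have hcont := hs.continuousOn
  refine ⟨hder, hcont 0 self_mem_Ici, h0, hlim, ?_, integrableOn_Ioi_deriv_of_nonpos
    (hcont 0 self_mem_Ici) hder hneg hlim⟩
  rw [← Ioc_union_Ioi_eq_Ioi hT.le]
  refine IntegrableOn.union ?_ ?_
  · exact ((hcont.mono Icc_subset_Ici_self).integrableOn_Icc).mono_set Ioc_subset_Icc_self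
  · refine Integrable.mono' (integrableOn_exp_mul_Ioi (neg_lt_zero.2 hρ) T)
      ((hcont.mono fun t ht => (hT.trans ht).le).aestronglyMeasurable measurableSet_Ioi) ?_
    filter_upwards [ae_restrict_mem measurableSet_Ioi] with t ht
    rw [Real.norm_of_nonneg (hnn t (hT.trans ht).le)]
    exact hd t (le_of_lt ht)

lemma integrableOn_mul_shift {w m : ℝ → ℝ} (hw : IntegrableOn w (Ioi 0))
    (hm : ContinuousOn m (Ici 0)) {B : ℝ} (hB : ∀ t, 0 ≤ t → |m t| ≤ B) {s : ℝ} (hs : 0 ≤ s) :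
    IntegrableOn (fun t => w t * m (t + s)) (Ioi 0) := by
  have hmeas : AEStronglyMeasurable (fun t => m (t + s)) (volume.restrict (Ioi 0)) :=
    (hm.comp (by fun_prop) fun t ht => add_nonneg (le_of_lt ht) hs).aestronglyMeasurable
      measurableSet_Ioi
  refine Integrable.mul_bdd (c := B) hw hmeas ?_
  filter_upwards [ae_restrict_mem measurableSet_Ioi] with t ht
  exact hB _ (add_nonneg (le_of_lt ht) hs)

lemma IsDiscountFactor.hasDerivWithinAt_integral_shift {h m m' : ℝ → ℝ} (hh : IsDiscountFactor h)
    (hm : ∀ t, 0 ≤ t → HasDerivAt m (m' t) t) (hm' : ContinuousOn m' (Ici 0)) {B B' : ℝ}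
    (hB : ∀ t, 0 ≤ t → |m t| ≤ B) (hB' : ∀ t, 0 ≤ t → |m' t| ≤ B') {s : ℝ} (hs : 0 ≤ s) :
    HasDerivWithinAt (fun s => ∫ t in Ioi (0 : ℝ), h t * m (t + s))
      (-m s - ∫ t in Ioi (0 : ℝ), deriv h t * m (t + s)) (Ici 0) s := by
  obtain ⟨M, hM, hMm⟩ := exists_hasDerivAt_extension hm hm'
  have hmc : ContinuousOn m (Ici 0) := HasDerivAt.continuousOn fun t ht => hm t ht
  have hMc : Continuous M := continuous_iff_continuousAt.2 fun t => (hM t).continuousAt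
  have hMc' : Continuous fun t : ℝ => m' (max t 0) :=
    hm'.comp_continuous (by fun_prop) fun t => le_max_right t 0
  have hEq : ∀ w : ℝ → ℝ, ∀ r, 0 ≤ r →
      ∫ t in Ioi (0 : ℝ), w t * m (t + r) = ∫ t in Ioi (0 : ℝ), w t * M (t + r) := fun w r hr =>
    setIntegral_congr_fun measurableSet_Ioi fun t ht => by
      simp only [hMm _ (add_nonneg (le_of_lt ht) hr)]
  have hshift : ∀ t : ℝ, ∀ x, HasDerivAt (fun x => M (t + x)) (m' (max (t + x) 0)) x :=
    fun t x => (hM (t + x)).comp_const_add t x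
  have hmeas : AEStronglyMeasurable h (volume.restrict (Ioi 0)) := hh.integrableOn.1
  have hD := (hasDerivAt_integral_of_dominated_loc_of_deriv_le (μ := volume.restrict (Ioi (0 : ℝ)))
    (F := fun x t => h t * M (t + x)) (F' := fun x t => h t * m' (max (t + x) 0)) (x₀ := s)
    (bound := fun t => ‖h t‖ * B') univ_mem
    (Eventually.of_forall fun x => hmeas.mul (by fun_prop))
    ((integrableOn_mul_shift hh.integrableOn hmc hB hs).congr_fun (fun t ht => by
      simp only [hMm _ (add_nonneg (le_of_lt ht) hs)]) measurableSet_Ioi)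
    (hmeas.mul (hMc'.comp (continuous_id.add continuous_const)).aestronglyMeasurable)
    (Eventually.of_forall fun t x _ => by
      rw [norm_mul]
      exact mul_le_mul_of_nonneg_left (hB' _ (le_max_right _ _)) (norm_nonneg _))
    (hh.integrableOn.norm.mul_const B')
    (Eventually.of_forall fun t x _ => (hshift t x).const_mul (h t))).2
  have hparts : ∫ t in Ioi (0 : ℝ), h t * m' (max (t + s) 0) =
      0 - m s - ∫ t in Ioi (0 : ℝ), deriv h t * M (t + s) := by
    refine integral_Ioi_mul_deriv_eq_deriv_mul (v := fun t => M (t + s))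
      (fun t ht => hh.hasDerivAt t ht)
      (fun t _ => (hM (t + s)).comp_add_const t s) ?_ ?_ ?_ ?_
    · exact (integrableOn_mul_shift hh.integrableOn hm' hB' hs).congr_fun (fun t ht => by
        simp only [Pi.mul_apply, max_eq_left (add_nonneg (le_of_lt (mem_Ioi.1 ht)) hs)])
        measurableSet_Ioi
    · exact (integrableOn_mul_shift hh.integrableOn_deriv hmc hB hs).congr_fun (fun t ht => by
        simp only [Pi.mul_apply, hMm _ (add_nonneg (le_of_lt (mem_Ioi.1 ht)) hs)])
        measurableSet_Ioi
    · have h1 : Tendsto h (𝓝[>] 0) (𝓝 1) := by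
        simpa only [hh.zero] using
          (hh.continuousWithinAt.mono Ioi_subset_Ici_self).tendsto
      have h2 : Tendsto (fun t => M (t + s)) (𝓝[>] 0) (𝓝 (m s)) := by
        have : Continuous fun t => M (t + s) := by fun_prop
        simpa [hMm s hs] using (this.tendsto 0).mono_left nhdsWithin_le_nhds
      rw [← one_mul (m s)]
      exact h1.mul h2
    · refine squeeze_zero_norm' (a := fun t => |h t| * B) ?_
        (by simpa using hh.tendsto.abs.mul_const B)
      filter_upwards [eventually_ge_atTop 0] with t ht
      rw [Pi.mul_apply, norm_mul, hMm _ (add_nonneg ht hs)]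
      exact mul_le_mul_of_nonneg_left (hB _ (add_nonneg ht hs)) (norm_nonneg _)
  rw [hparts, zero_sub, ← hEq _ s hs] at hD
  exact hD.hasDerivWithinAt.congr (fun r hr => hEq h r hr) (hEq h s hs)

lemma tendsto_integral_shift_atTop {w m : ℝ → ℝ} (hw : IntegrableOn w (Ioi 0))
    (hm : ContinuousOn m (Ici 0)) {l : ℝ} (hl : Tendsto m atTop (𝓝 l)) :
    Tendsto (fun s => ∫ t in Ioi (0 : ℝ), w t * m (t + s)) atTop
      (𝓝 (l * ∫ t in Ioi (0 : ℝ), w t)) := by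
  obtain ⟨B, hB⟩ := exists_bound_of_continuousOn_Ici_of_tendsto hm hl
  rw [mul_comm, ← integral_mul_const]
  refine tendsto_integral_filter_of_dominated_convergence (fun t => ‖w t‖ * B) ?_ ?_
    (hw.norm.mul_const B) ?_
  · filter_upwards [eventually_ge_atTop 0] with s hs
    exact (integrableOn_mul_shift hw hm hB hs).1
  · filter_upwards [eventually_ge_atTop 0] with s hs
    filter_upwards [ae_restrict_mem measurableSet_Ioi] with t ht
    rw [norm_mul]
    exact mul_le_mul_of_nonneg_left (hB _ (add_nonneg (le_of_lt ht) hs)) (norm_nonneg _)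
  · exact Eventually.of_forall fun t =>
      (hl.comp (tendsto_atTop_add_const_left _ t tendsto_id)).const_mul (w t)

/-- A `C¹` function evaluated along a convergent trajectory is a bounded `C¹` function of time
with bounded derivative, so its discounted integral is differentiable along the trajectory. -/
lemma IsDiscountFactor.hasDerivWithinAt_integral_flow {h g v x : ℝ → ℝ} {N : Set ℝ} {a : ℝ}
    (hh : IsDiscountFactor h) (hN : IsOpen N) (hg : ContDiffOn ℝ 1 g N) (hv : ContinuousOn v N)
    (hx : ∀ t, 0 ≤ t → HasDerivAt x (v (x t)) t) (hxN : ∀ t, 0 ≤ t → x t ∈ N) (haN : a ∈ N)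
    (ha : Tendsto x atTop (𝓝 a)) {s : ℝ} (hs : 0 ≤ s) :
    HasDerivWithinAt (fun s => ∫ t in Ioi (0 : ℝ), h t * g (x (t + s)))
      (-g (x s) - ∫ t in Ioi (0 : ℝ), deriv h t * g (x (t + s))) (Ici 0) s := by
  have hxc : ContinuousOn x (Ici 0) := HasDerivAt.continuousOn fun t ht => hx t ht
  have hgd : ∀ k ∈ N, HasDerivAt g (deriv g k) k := fun k hk =>
    ((hg.differentiableOn (by simp)).differentiableAt (hN.mem_nhds hk)).hasDerivAt
  have hgv : ContinuousOn (fun k => deriv g k * v k) N :=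
    (hg.continuousOn_deriv_of_isOpen hN le_rfl).mul hv
  have hm' : ContinuousOn (fun t => deriv g (x t) * v (x t)) (Ici 0) :=
    hgv.comp hxc fun t ht => hxN t ht
  have hmc : ContinuousOn (fun t => g (x t)) (Ici 0) :=
    hg.continuousOn.comp hxc fun t ht => hxN t ht
  obtain ⟨B, hB⟩ := exists_bound_of_continuousOn_Ici_of_tendsto hmc
    ((hg.continuousOn.continuousAt (hN.mem_nhds haN)).tendsto.comp ha)
  obtain ⟨B', hB'⟩ := exists_bound_of_continuousOn_Ici_of_tendsto hm'
    ((hgv.continuousAt (hN.mem_nhds haN)).tendsto.comp ha)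
  exact hh.hasDerivWithinAt_integral_shift (m := fun t => g (x t))
    (fun t ht => (hgd _ (hxN t ht)).comp t (hx t ht)) hm' hB hB' hs

/-- Equivalence of the integral equation (IE) and the
integro-differential equation (DE) with the boundary condition (BC).
Let `V` be `C²` on a neighborhood `N` of `kbar` such that the strategy
`σ(k) = φ(V'(k),k)` is convergent to `kbar` on `N`, with flow `K`. Then `V` satisfies
(IE) on `N` iff it satisfies (DE) on `N` together with (BC). -/
theorem stmt_6
    (f : ℝ → ℝ) (u U : ℝ → ℝ → ℝ) (h H : ℝ → ℝ)
    (hf_conc : ConcaveOn ℝ (Set.Ici 0) f)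
    (hf_cont : ContinuousOn f (Set.Ici 0))
    (hf_smooth : ContDiffOn ℝ (⊤ : ℕ∞) f (Set.Ioi 0))
    (hf_inada0 : Tendsto (deriv f) (nhdsWithin 0 (Set.Ioi 0)) atTop)
    (hf_inada1 : ∃ L ≤ (0:ℝ), Tendsto (deriv f) atTop (nhds L))
    (hu_smooth : ContDiffOn ℝ (⊤ : ℕ∞) (fun p : ℝ × ℝ => u p.1 p.2) (Set.Ioi 0 ×ˢ Set.Ioi 0))
    (hU_smooth : ContDiffOn ℝ (⊤ : ℕ∞) (fun p : ℝ × ℝ => U p.1 p.2) (Set.Ioi 0 ×ˢ Set.Ioi 0))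
    (hu_mono : ∀ k > (0:ℝ), StrictMonoOn (fun c => u c k) (Set.Ioi 0))
    (hU_mono : ∀ k > (0:ℝ), StrictMonoOn (fun c => U c k) (Set.Ioi 0))
    (hu11 : ∀ c > (0:ℝ), ∀ k > (0:ℝ), pd11 u c k < 0)
    (hU11 : ∀ c > (0:ℝ), ∀ k > (0:ℝ), pd11 U c k < 0)
    (hh_smooth : ContDiffOn ℝ (⊤ : ℕ∞) h (Set.Ici 0))
    (hH_smooth : ContDiffOn ℝ (⊤ : ℕ∞) H (Set.Ici 0))
    (hh_anti : AntitoneOn h (Set.Ici 0)) (hH_anti : AntitoneOn H (Set.Ici 0))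
    (hh0 : h 0 = 1) (hH0 : H 0 = 1)
    (hh_lim : Tendsto h atTop (nhds 0)) (hH_lim : Tendsto H atTop (nhds 0))
    (hdecay : ∃ ρ > (0:ℝ), ∃ T > (0:ℝ), ∀ t ≥ T,
      h t ≤ Real.exp (-ρ * t) ∧ H t ≤ Real.exp (-ρ * t))
    (φ : ℝ → ℝ → ℝ)
    (hφ : ∀ k > (0:ℝ), ∀ x > (0:ℝ),
      0 < φ x k ∧ pd1 u (φ x k) k + pd1 U (φ x k) k = x)
    (N : Set ℝ) (hNopen : IsOpen N) (hNpos : N ⊆ Set.Ioi 0)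
    (kbar : ℝ) (hkbarN : kbar ∈ N)
    (V : ℝ → ℝ) (hVC2 : ContDiffOn ℝ 2 V N) (hVpos : ∀ k ∈ N, 0 < deriv V k)
    (σ : ℝ → ℝ) (hσdef : ∀ k ∈ N, σ k = φ (deriv V k) k)
    (hσC1 : ContDiffOn ℝ 1 σ N)
    (K : ℝ → ℝ → ℝ)
    (hK0 : ∀ k₀ ∈ N, K 0 k₀ = k₀)
    (hKode : ∀ k₀ ∈ N, ∀ t : ℝ, 0 ≤ t →
      HasDerivAt (fun s => K s k₀) (f (K t k₀) - σ (K t k₀)) t)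
    (hKstay : ∀ k₀ ∈ N, ∀ t : ℝ, 0 ≤ t → K t k₀ ∈ N)
    (hKconv : ∀ k₀ ∈ N, Tendsto (fun t => K t k₀) atTop (nhds kbar)) :
    -- (IE) on N  ↔  (DE) on N together with (BC)
    ((∀ k₀ ∈ N, V k₀ =
        (∫ t in Set.Ioi (0:ℝ), h t * u (σ (K t k₀)) (K t k₀)) +
        ∫ t in Set.Ioi (0:ℝ), H t * U (σ (K t k₀)) (K t k₀))
     ↔
     ((∀ k₀ ∈ N,
        u (σ k₀) k₀ + U (σ k₀) k₀ + deriv V k₀ * (f k₀ - σ k₀) =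
        -(∫ t in Set.Ioi (0:ℝ), deriv h t * u (σ (K t k₀)) (K t k₀)) -
          ∫ t in Set.Ioi (0:ℝ), deriv H t * U (σ (K t k₀)) (K t k₀)) ∧
      V kbar = u (f kbar) kbar * (∫ t in Set.Ioi (0:ℝ), h t) +
               U (f kbar) kbar * ∫ t in Set.Ioi (0:ℝ), H t)) := by
  obtain ⟨ρ, hρ, T, hT, hd⟩ := hdecay
  have dh := isDiscountFactor_of_le_exp hh_smooth hh_anti hh0 hh_lim hρ hT fun t ht => (hd t ht).1
  have dH := isDiscountFactor_of_le_exp hH_smooth hH_anti hH0 hH_lim hρ hT fun t ht => (hd t ht).2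
  have hσpos : ∀ k ∈ N, 0 < σ k := fun k hk => by
    rw [hσdef k hk]
    exact (hφ k (hNpos hk) _ (hVpos k hk)).1
  have hmaps : MapsTo (fun k => (σ k, k)) N (Ioi 0 ×ˢ Ioi 0) := fun k hk => ⟨hσpos k hk, hNpos hk⟩
  have hg : ContDiffOn ℝ 1 (fun k => u (σ k) k) N :=
    (hu_smooth.of_le (by simp)).comp (hσC1.prodMk contDiffOn_id) hmaps
  have hG : ContDiffOn ℝ 1 (fun k => U (σ k) k) N :=
    (hU_smooth.of_le (by simp)).comp (hσC1.prodMk contDiffOn_id) hmaps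
  have hv1 : ContDiffOn ℝ 1 (fun k => f k - σ k) N :=
    ((hf_smooth.mono hNpos).of_le (by simp)).sub hσC1
  have hvlip := contDiffOn_locallyLipschitzOn_of_isOpen hNopen hv1
  have hsemi : ∀ k₀ ∈ N, ∀ s, 0 ≤ s → ∀ t, 0 ≤ t → K t (K s k₀) = K (t + s) k₀ := by
    intro k₀ hk s hs t ht
    refine autonomous_ode_unique (x := fun t => K t (K s k₀)) (y := fun t => K (t + s) k₀) hvlip
      (hKode _ (hKstay k₀ hk s hs)) (fun r hr => ?_) (hKstay _ (hKstay k₀ hk s hs))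
      (fun r hr => hKstay k₀ hk _ (add_nonneg hr hs)) ?_ ht
    · exact (hKode k₀ hk (r + s) (add_nonneg hr hs)).comp_add_const r s
    · simp [hK0 _ (hKstay k₀ hk s hs)]
  have hstat : f kbar - σ kbar = 0 :=
    eq_zero_of_tendsto_of_tendsto_deriv (hKode kbar hkbarN) (hKconv kbar hkbarN)
      ((hv1.continuousOn.continuousAt (hNopen.mem_nhds hkbarN)).tendsto.comp (hKconv kbar hkbarN))
  have hσbar : σ kbar = f kbar := by linarith
  have hKbar : ∀ t, 0 ≤ t → K t kbar = kbar := fun t ht =>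
    autonomous_ode_unique (x := fun t => K t kbar) (y := fun _ => kbar) hvlip (hKode kbar hkbarN)
      (fun r _ => by simpa only [hstat] using hasDerivAt_const r kbar) (hKstay kbar hkbarN)
      (fun _ _ => hkbarN) (hK0 kbar hkbarN) ht
  set g : ℝ → ℝ := fun k => u (σ k) k
  set G : ℝ → ℝ := fun k => U (σ k) k
  have hflow : ∀ w q : ℝ → ℝ, ∀ k₀ ∈ N, ∀ s, 0 ≤ s →
      ∫ t in Ioi (0 : ℝ), w t * q (K t (K s k₀)) = ∫ t in Ioi (0 : ℝ), w t * q (K (t + s) k₀) :=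
    fun w q k₀ hk s hs => setIntegral_congr_fun measurableSet_Ioi fun t ht => by
      simp only [hsemi k₀ hk s hs t (le_of_lt ht)]
  set W : ℝ → ℝ := fun k => (∫ t in Ioi (0 : ℝ), h t * g (K t k)) +
    ∫ t in Ioi (0 : ℝ), H t * G (K t k) with hW
  set R : ℝ → ℝ := fun k => -(∫ t in Ioi (0 : ℝ), deriv h t * g (K t k)) -
    ∫ t in Ioi (0 : ℝ), deriv H t * G (K t k) with hR
  have hWflow : ∀ k₀ ∈ N, ∀ s, 0 ≤ s → HasDerivWithinAt (fun s => W (K s k₀))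
      (R (K s k₀) - g (K s k₀) - G (K s k₀)) (Ici 0) s := by
    intro k₀ hk s hs
    have h1 := dh.hasDerivWithinAt_integral_flow hNopen hg hv1.continuousOn (hKode k₀ hk)
      (hKstay k₀ hk) hkbarN (hKconv k₀ hk) hs
    have h2 := dH.hasDerivWithinAt_integral_flow hNopen hG hv1.continuousOn (hKode k₀ hk)
      (hKstay k₀ hk) hkbarN (hKconv k₀ hk) hs
    have hWs : ∀ r, 0 ≤ r → W (K r k₀) = (∫ t in Ioi (0 : ℝ), h t * g (K (t + r) k₀)) +
        ∫ t in Ioi (0 : ℝ), H t * G (K (t + r) k₀) := fun r hr => by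
      simp only [hW, hflow _ _ k₀ hk r hr]
    refine ((h1.add h2).congr (fun r hr => hWs r hr) (hWs s hs)).congr_deriv ?_
    simp only [hR, hflow _ _ k₀ hk s hs]
    ring
  have hVflow : ∀ k₀ ∈ N, ∀ s, 0 ≤ s → HasDerivWithinAt (fun s => V (K s k₀))
      (deriv V (K s k₀) * (f (K s k₀) - σ (K s k₀))) (Ici 0) s := fun k₀ hk s hs =>
    ((((hVC2.differentiableOn (by simp)).differentiableAt
      (hNopen.mem_nhds (hKstay k₀ hk s hs))).hasDerivAt).comp s (hKode k₀ hk s hs)).hasDerivWithinAt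
  have hWbar : W kbar = g kbar * (∫ t in Ioi (0 : ℝ), h t) +
      G kbar * ∫ t in Ioi (0 : ℝ), H t := by
    have hc : ∀ w q : ℝ → ℝ, ∫ t in Ioi (0 : ℝ), w t * q (K t kbar) =
        q kbar * ∫ t in Ioi (0 : ℝ), w t := fun w q => by
      rw [mul_comm, ← integral_mul_const]
      exact setIntegral_congr_fun measurableSet_Ioi fun t ht => by
        simp only [hKbar t (le_of_lt ht)]
    simp only [hW, hc h g, hc H G]
  change (∀ k₀ ∈ N, V k₀ = W k₀) ↔
    (∀ k₀ ∈ N, g k₀ + G k₀ + deriv V k₀ * (f k₀ - σ k₀) = R k₀) ∧ _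
  rw [← hσbar]
  change _ ↔ _ ∧ V kbar = g kbar * _ + G kbar * _
  rw [← hWbar]
  constructor
  · refine fun hIE => ⟨fun k₀ hk => ?_, hIE kbar hkbarN⟩
    have h1 := hVflow k₀ hk 0 le_rfl
    have h2 := (hWflow k₀ hk 0 le_rfl).congr (fun s hs => hIE _ (hKstay k₀ hk s hs))
      (hIE _ (hKstay k₀ hk 0 le_rfl))
    have h3 := (uniqueDiffOn_Ici (0 : ℝ) 0 self_mem_Ici).eq_deriv _ h1 h2
    simp only [hK0 k₀ hk] at h3
    linarith
  · rintro ⟨hDE, hBC⟩ k₀ hk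
    have hzero : ∀ s, 0 ≤ s →
        HasDerivWithinAt (fun s => V (K s k₀) - W (K s k₀)) 0 (Ici 0) s := fun s hs => by
      refine ((hVflow k₀ hk s hs).sub (hWflow k₀ hk s hs)).congr_deriv ?_
      linarith [hDE _ (hKstay k₀ hk s hs)]
    have hconst : ∀ s, 0 ≤ s → V (K s k₀) - W (K s k₀) = V k₀ - W k₀ := fun s hs => by
      have := constant_of_has_deriv_right_zero (f := fun s => V (K s k₀) - W (K s k₀)) (a := 0)
        (b := s) (fun r hr => ((hzero r hr.1).continuousWithinAt).mono Icc_subset_Ici_self)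
        (fun r hr => (hzero r hr.1).mono (Ici_subset_Ici.2 hr.1)) s (right_mem_Icc.2 hs)
      simpa only [hK0 k₀ hk] using this
    have hKc : ContinuousOn (fun t => K t k₀) (Ici 0) :=
      HasDerivAt.continuousOn fun t ht => hKode k₀ hk t ht
    have hlim : ∀ q : ℝ → ℝ, ContinuousOn q N →
        Tendsto (fun t => q (K t k₀)) atTop (𝓝 (q kbar)) := fun q hq =>
      (hq.continuousAt (hNopen.mem_nhds hkbarN)).tendsto.comp (hKconv k₀ hk)
    have hWlim : Tendsto (fun s => W (K s k₀)) atTop (𝓝 (W kbar)) := by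
      have h1 := tendsto_integral_shift_atTop dh.integrableOn
        (hg.continuousOn.comp hKc fun t ht => hKstay k₀ hk t ht) (hlim g hg.continuousOn)
      have h2 := tendsto_integral_shift_atTop dH.integrableOn
        (hG.continuousOn.comp hKc fun t ht => hKstay k₀ hk t ht) (hlim G hG.continuousOn)
      rw [hWbar]
      refine (h1.add h2).congr' ?_
      filter_upwards [eventually_ge_atTop 0] with s hs
      simp only [hW, hflow _ _ k₀ hk s hs]
      rfl
    have hdiff := (hlim V hVC2.continuousOn).sub hWlim
    rw [hBC, sub_self] at hdiff
    have hc : Tendsto (fun s => V (K s k₀) - W (K s k₀)) atTop (𝓝 (V k₀ - W k₀)) :=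
      tendsto_const_nhds.congr' (by
        filter_upwards [eventually_ge_atTop 0] with s hs using (hconst s hs).symm)
    exact sub_eq_zero.1 (tendsto_nhds_unique hc hdiff)
end

section
/- (Uniqueness lemma for the degenerate linear system) Let δ₁>δ₂>0, a=(δ₁+δ₂)/2, b=(δ₁−δ₂)/2. Let ξ be a continuous real function on an interval around k∞ with ξ(k∞)=0, ξ(k)≥0 for k≤k∞ and ξ(k)≤0 for k≥k∞. If (v,w) is a pair of continuous functions on a neighborhood of k∞, continuously differentiable at every k≠k∞, which satisfy ξ(k)·v′(k) = a·v(k) + b·w(k) and ξ(k)·w′(k) = b·v(k) + a·w(k) for all k≠k∞ in that neighborhood, and v(k∞)=w(k∞)=0, then v ≡ 0 and w ≡ 0 on that neighborhood. -/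
open Filter Set

/-- A function vanishing at `c` whose derivative is negative wherever it is positive on `(c, d]`
is nonpositive at `d`. -/
theorem nonpos_of_deriv_neg_of_pos {u : ℝ → ℝ} {c d : ℝ} (hcd : c ≤ d)
    (hu : ContinuousOn u (Icc c d)) (hc : u c = 0)
    (hdiff : ∀ x ∈ Ioc c d, DifferentiableAt ℝ u x)
    (hneg : ∀ x ∈ Ioc c d, 0 < u x → deriv u x < 0) : u d ≤ 0 := by
  by_contra! hd
  obtain ⟨m, hm, hmax⟩ := isCompact_Icc.exists_isMaxOn (nonempty_Icc.2 hcd) hu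
  have hpos : 0 < u m := hd.trans_le (hmax (right_mem_Icc.2 hcd))
  have hcm : c < m := hm.1.lt_of_ne fun h => by
    rw [← h, hc] at hpos
    exact hpos.false
  have hmem : m ∈ Ioc c d := ⟨hcm, hm.2⟩
  have hcone : c - m ∈ posTangentConeAt (Icc c d) m :=
    sub_mem_posTangentConeAt_of_segment_subset
      ((convex_Icc c d).segment_subset hm (left_mem_Icc.2 hcd))
  have key := hmax.localize.hasFDerivWithinAt_nonpos
    (hdiff m hmem).hasDerivAt.hasFDerivAt.hasFDerivWithinAt hcone
  have hder := hneg m hmem hpos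
  simp only [ContinuousLinearMap.toSpanSingleton_apply, smul_eq_mul] at key
  nlinarith

/-- A solution of `ξ u' = δ u` on `(c, d]` with `ξ ≤ 0 < δ` and `u c = 0` vanishes at `d`. -/
theorem eq_zero_of_mul_deriv_eq_right {u ξ : ℝ → ℝ} {c d δ : ℝ} (hδ : 0 < δ) (hcd : c ≤ d)
    (hu : ContinuousOn u (Icc c d)) (hc : u c = 0)
    (hdiff : ∀ x ∈ Ioc c d, DifferentiableAt ℝ u x)
    (hξ : ∀ x ∈ Ioc c d, ξ x ≤ 0)
    (hode : ∀ x ∈ Ioc c d, ξ x * deriv u x = δ * u x) : u d = 0 := by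
  apply le_antisymm
  · refine nonpos_of_deriv_neg_of_pos hcd hu hc hdiff fun x hx hpos => ?_
    by_contra! h
    linarith [mul_pos hδ hpos, hode x hx, mul_nonpos_of_nonpos_of_nonneg (hξ x hx) h]
  · have := nonpos_of_deriv_neg_of_pos (u := fun x => -u x) hcd hu.neg (by simp [hc])
      (fun x hx => (hdiff x hx).neg) fun x hx hpos => by
        rw [deriv.fun_neg]
        by_contra! h
        have h₁ := mul_nonpos_of_nonpos_of_nonneg (hξ x hx) h
        linarith [mul_pos hδ hpos, hode x hx]
    linarith

/-- A solution of `ξ u' = δ u` on `[c, d)` with `0 ≤ ξ`, `0 < δ` and `u d = 0` vanishes at `c`. -/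
theorem eq_zero_of_mul_deriv_eq_left {u ξ : ℝ → ℝ} {c d δ : ℝ} (hδ : 0 < δ) (hcd : c ≤ d)
    (hu : ContinuousOn u (Icc c d)) (hd : u d = 0)
    (hdiff : ∀ x ∈ Ico c d, DifferentiableAt ℝ u x)
    (hξ : ∀ x ∈ Ico c d, 0 ≤ ξ x)
    (hode : ∀ x ∈ Ico c d, ξ x * deriv u x = δ * u x) : u c = 0 := by
  have hmem : ∀ x ∈ Ioc (-d) (-c), -x ∈ Ico c d := fun x hx =>
    ⟨by linarith [hx.2], by linarith [hx.1]⟩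
  have := eq_zero_of_mul_deriv_eq_right (u := fun x => u (-x)) (ξ := fun x => -ξ (-x)) hδ
    (neg_le_neg hcd)
    (hu.comp continuousOn_neg fun x hx => ⟨by linarith [hx.2], by linarith [hx.1]⟩)
    (by simpa using hd)
    (fun x hx => (hdiff _ (hmem x hx)).comp x differentiableAt_id.neg)
    (fun x hx => neg_nonpos.2 (hξ _ (hmem x hx)))
    (fun x hx => by
      rw [deriv_comp_neg]
      linarith [hode _ (hmem x hx)])
  simpa using this

/-- If `ξ u' = δ u` away from `c`, with `δ > 0`, `ξ ≥ 0` to the left and `ξ ≤ 0` to the right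
of `c`, and `u c = 0`, then `u = 0`. -/
theorem eq_zero_of_mul_deriv_eq {u ξ : ℝ → ℝ} {c δ : ℝ} {s : Set ℝ} (hs : s.OrdConnected)
    (hcs : c ∈ s) (hδ : 0 < δ) (hu : ContinuousOn u s) (hc : u c = 0)
    (hdiff : ∀ x ∈ s, x ≠ c → DifferentiableAt ℝ u x)
    (hleft : ∀ x ∈ s, x ≤ c → 0 ≤ ξ x) (hright : ∀ x ∈ s, c ≤ x → ξ x ≤ 0)
    (hode : ∀ x ∈ s, x ≠ c → ξ x * deriv u x = δ * u x) {k : ℝ} (hk : k ∈ s) : u k = 0 := by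
  rcases le_total c k with hck | hkc
  · have hsub := hs.out hcs hk
    exact eq_zero_of_mul_deriv_eq_right hδ hck (hu.mono hsub) hc
      (fun x hx => hdiff x (hsub (Ioc_subset_Icc_self hx)) hx.1.ne')
      (fun x hx => hright x (hsub (Ioc_subset_Icc_self hx)) hx.1.le)
      (fun x hx => hode x (hsub (Ioc_subset_Icc_self hx)) hx.1.ne')
  · have hsub := hs.out hk hcs
    exact eq_zero_of_mul_deriv_eq_left hδ hkc (hu.mono hsub) hc
      (fun x hx => hdiff x (hsub (Ico_subset_Icc_self hx)) hx.2.ne)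
      (fun x hx => hleft x (hsub (Ico_subset_Icc_self hx)) hx.2.le)
      (fun x hx => hode x (hsub (Ico_subset_Icc_self hx)) hx.2.ne)

/-- Uniqueness lemma for the degenerate linear system.
Let `δ₁ > δ₂ > 0`, `a = (δ₁+δ₂)/2`, `b = (δ₁−δ₂)/2`, and let `ξ` be continuous on an
interval around `kinf` with `ξ(kinf) = 0`, `ξ ≥ 0` left of `kinf` and `ξ ≤ 0` right of
`kinf`. If `(v,w)` are continuous on the interval, continuously differentiable away from
`kinf`, satisfy `ξ v' = a v + b w` and `ξ w' = b v + a w` there, and vanish at `kinf`,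
then `v ≡ 0` and `w ≡ 0` on the interval. -/
theorem stmt_9
    (δ₁ δ₂ : ℝ) (hδ : δ₂ < δ₁) (hδ₂ : 0 < δ₂)
    (a b : ℝ) (ha : a = (δ₁ + δ₂) / 2) (hb : b = (δ₁ - δ₂) / 2)
    (kinf ε : ℝ) (hε : 0 < ε)
    (ξ v w : ℝ → ℝ)
    (hξcont : ContinuousOn ξ (Set.Ioo (kinf - ε) (kinf + ε)))
    (hξ0 : ξ kinf = 0)
    (hξleft : ∀ k ∈ Set.Ioo (kinf - ε) (kinf + ε), k ≤ kinf → 0 ≤ ξ k)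
    (hξright : ∀ k ∈ Set.Ioo (kinf - ε) (kinf + ε), kinf ≤ k → ξ k ≤ 0)
    (hvcont : ContinuousOn v (Set.Ioo (kinf - ε) (kinf + ε)))
    (hwcont : ContinuousOn w (Set.Ioo (kinf - ε) (kinf + ε)))
    (hd : ∀ k ∈ Set.Ioo (kinf - ε) (kinf + ε), k ≠ kinf →
      ContDiffAt ℝ 1 v k ∧ ContDiffAt ℝ 1 w k ∧
      ξ k * deriv v k = a * v k + b * w k ∧
      ξ k * deriv w k = b * v k + a * w k)
    (hv0 : v kinf = 0) (hw0 : w kinf = 0) :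
    ∀ k ∈ Set.Ioo (kinf - ε) (kinf + ε), v k = 0 ∧ w k = 0 := by
  intro k hk
  have hmem : kinf ∈ Ioo (kinf - ε) (kinf + ε) := ⟨by linarith, by linarith⟩
  have hdv : ∀ x ∈ Ioo (kinf - ε) (kinf + ε), x ≠ kinf → DifferentiableAt ℝ v x :=
    fun x hx hne => (hd x hx hne).1.differentiableAt one_ne_zero
  have hdw : ∀ x ∈ Ioo (kinf - ε) (kinf + ε), x ≠ kinf → DifferentiableAt ℝ w x :=
    fun x hx hne => (hd x hx hne).2.1.differentiableAt one_ne_zero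
  have hadd : v k + w k = 0 :=
    eq_zero_of_mul_deriv_eq (u := fun x => v x + w x) ordConnected_Ioo hmem (hδ₂.trans hδ)
      (hvcont.add hwcont) (by simp [hv0, hw0])
      (fun x hx hne => (hdv x hx hne).add (hdw x hx hne)) hξleft hξright
      (fun x hx hne => by
        obtain ⟨-, -, h₁, h₂⟩ := hd x hx hne
        rw [deriv_fun_add (hdv x hx hne) (hdw x hx hne), mul_add, h₁, h₂, ha, hb]
        ring) hk
  have hsub : v k - w k = 0 :=
    eq_zero_of_mul_deriv_eq (u := fun x => v x - w x) ordConnected_Ioo hmem hδ₂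
      (hvcont.sub hwcont) (by simp [hv0, hw0])
      (fun x hx hne => (hdv x hx hne).sub (hdw x hx hne)) hξleft hξright
      (fun x hx hne => by
        obtain ⟨-, -, h₁, h₂⟩ := hd x hx hne
        rw [deriv_fun_sub (hdv x hx hne) (hdw x hx hne), mul_sub, h₁, h₂, ha, hb]
        ring) hk
  constructor <;> linarith
end
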